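/- arXiv:2102.10654 — 2 statements merged into one kernel-verified Lean document; each statement's English description precedes it below -/
import Mathlib

section
/- Let v_a and v_b be two non-degenerate cancelable valuations over the item set M, and consider n agents each of whose valuation equals v_a or v_b. Given any partial EFX allocation X with at least one unallocated item, there exists a partial EFX allocation that Pareto dominates X. -/
namespace FairDivision

open Finset

/-- A valuation: nonnegative, zero on the empty set, monotone. -/
def IsValuation {ι : Type*} (v : Finset ι → ℝ) : Prop :=
  v ∅ = 0 ∧ (∀ S : Finset ι, 0 ≤ v S) ∧ ∀ ⦃S T : Finset ι⦄, S ⊆ T → v S ≤ v T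

/-- `v` is cancelable: `v (S ∪ {g}) > v (T ∪ {g})` implies `v S > v T`. -/
def Cancelable {ι : Type*} [DecidableEq ι] (v : Finset ι → ℝ) : Prop :=
  ∀ S T : Finset ι, ∀ g : ι, g ∉ S → g ∉ T →
    v (insert g S) > v (insert g T) → v S > v T

/-- `v` is non-degenerate: distinct bundles have distinct values. -/
def NonDegenerate {ι : Type*} (v : Finset ι → ℝ) : Prop :=
  ∀ S T : Finset ι, S ≠ T → v S ≠ v T

/-- `v'` respects `v`: every strict inequality of `v` is a strict inequality of `v'`. -/
def Respects {ι : Type*} (v' v : Finset ι → ℝ) : Prop :=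
  ∀ S T : Finset ι, v S > v T → v' S > v' T

/-- `v` is a nice cancelable valuation: cancelable, and some non-degenerate
cancelable valuation respects it. -/
def NiceCancelable {ι : Type*} [DecidableEq ι] (v : Finset ι → ℝ) : Prop :=
  Cancelable v ∧ ∃ v' : Finset ι → ℝ,
    IsValuation v' ∧ NonDegenerate v' ∧ Cancelable v' ∧ Respects v' v

/-- A partial allocation: the bundles are pairwise disjoint. -/
def IsPartialAlloc {ι : Type*} {n : ℕ} (X : Fin n → Finset ι) : Prop :=
  ∀ i j : Fin n, i ≠ j → Disjoint (X i) (X j)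

/-- The set of unallocated items. -/
def unalloc {ι : Type*} [DecidableEq ι] [Fintype ι] {n : ℕ}
    (X : Fin n → Finset ι) : Finset ι :=
  Finset.univ \ Finset.univ.biUnion X

/-- Agent `i` envies the set `S`. -/
def EnviesSet {ι : Type*} {n : ℕ} (v : Fin n → Finset ι → ℝ) (X : Fin n → Finset ι)
    (i : Fin n) (S : Finset ι) : Prop :=
  v i (X i) < v i S

/-- Agent `i` strongly envies the set `S`. -/
def StrongEnviesSet {ι : Type*} [DecidableEq ι] {n : ℕ} (v : Fin n → Finset ι → ℝ)
    (X : Fin n → Finset ι) (i : Fin n) (S : Finset ι) : Prop :=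
  ∃ h ∈ S, v i (X i) < v i (S.erase h)

/-- The allocation is EFX: no agent strongly envies another agent's bundle. -/
def IsEFX {ι : Type*} [DecidableEq ι] {n : ℕ} (v : Fin n → Finset ι → ℝ)
    (X : Fin n → Finset ι) : Prop :=
  ∀ i j : Fin n, i ≠ j → ¬ StrongEnviesSet v X i (X j)

/-- `Y` Pareto dominates `X`. -/
def ParetoDominates {ι : Type*} {n : ℕ} (v : Fin n → Finset ι → ℝ)
    (Y X : Fin n → Finset ι) : Prop :=
  (∀ i, v i (X i) ≤ v i (Y i)) ∧ ∃ i, v i (X i) < v i (Y i)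

/-- `Y` dominates `X` lexicographically with respect to the ordering `a` of the agents. -/
def Dominates {ι : Type*} {n : ℕ} (v : Fin n → Finset ι → ℝ) (a : Fin n → Fin n)
    (Y X : Fin n → Finset ι) : Prop :=
  ∃ k : Fin n, (∀ j : Fin n, j < k → v (a j) (Y (a j)) = v (a j) (X (a j))) ∧
    v (a k) (X (a k)) < v (a k) (Y (a k))

/-- Agent `i` is a most envious agent of the set `S`: there is `T ⊆ S` that `i`
envies and that no agent strongly envies.  (`S \ T` is a corresponding discard set.) -/
def MostEnvious {ι : Type*} [DecidableEq ι] {n : ℕ} (v : Fin n → Finset ι → ℝ)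
    (X : Fin n → Finset ι) (i : Fin n) (S : Finset ι) : Prop :=
  ∃ T ⊆ S, EnviesSet v X i T ∧ ∀ j : Fin n, ¬ StrongEnviesSet v X j T

/-- `i` champions `j` with respect to the item `g`:  `i` is a most envious agent
of `X j ∪ {g}`. -/
def ChampG {ι : Type*} [DecidableEq ι] {n : ℕ} (v : Fin n → Finset ι → ℝ)
    (X : Fin n → Finset ι) (g : ι) (i j : Fin n) : Prop :=
  MostEnvious v X i (insert g (X j))

/-- `i` champions `j` with respect to `(H | S)`:  `H ⊆ M \ X j`, `S ⊆ X j`, and `i`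
is a most envious agent of `(X j \ S) ∪ H`. -/
def GenChamp {ι : Type*} [DecidableEq ι] {n : ℕ} (v : Fin n → Finset ι → ℝ)
    (X : Fin n → Finset ι) (i j : Fin n) (H S : Finset ι) : Prop :=
  Disjoint H (X j) ∧ S ⊆ X j ∧ MostEnvious v X i ((X j \ S) ∪ H)

section Cancelable

variable {ι : Type*} [DecidableEq ι] {v : Finset ι → ℝ}

theorem Cancelable.lt_of_union_lt_union (hc : Cancelable v) {S T : Finset ι} (Z : Finset ι) :
    Disjoint Z S → Disjoint Z T → v (Z ∪ S) < v (Z ∪ T) → v S < v T := by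
  induction Z using Finset.induction_on with
  | empty => simp
  | insert z Z hz ih =>
    intro hS hT h
    rw [disjoint_insert_left] at hS hT
    rw [insert_union, insert_union] at h
    exact ih hS.2 hT.2 (hc _ _ z (by simp [hz, hT.1]) (by simp [hz, hS.1]) h)

theorem Cancelable.union_lt_union (hc : Cancelable v) (hnd : NonDegenerate v)
    {S T Z : Finset ι} (hS : Disjoint Z S) (hT : Disjoint Z T) (h : v S < v T) :
    v (Z ∪ S) < v (Z ∪ T) := by
  rcases lt_trichotomy (v (Z ∪ S)) (v (Z ∪ T)) with h' | h' | h'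
  · exact h'
  · have hST : Z ∪ S = Z ∪ T := by
      by_contra hne
      exact hnd _ _ hne h'
    have : S = T := by
      rw [← union_sdiff_cancel_left hS, hST, union_sdiff_cancel_left hT]
    exact absurd h (by simp [this])
  · exact absurd (hc.lt_of_union_lt_union Z hT hS h') h.not_gt

/-- If `T` arises from `B` by discarding `B \ T` and adding `g`, then comparing `B` with `T`
amounts to comparing `B \ T` with `g`, and this comparison persists over any other base `Z`. -/
theorem Cancelable.exchange (hc : Cancelable v) (hnd : NonDegenerate v)
    {B T Z : Finset ι} {g : ι} (hgB : g ∉ B) (hT : T ⊆ insert g B) (hgT : g ∈ T)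
    (hZB : Disjoint Z B) (hgZ : g ∉ Z) :
    (v B < v T → v (Z ∪ B \ T) < v (Z ∪ {g})) ∧
      (v T < v B → v (Z ∪ {g}) < v (Z ∪ B \ T)) := by
  have hB : B = T.erase g ∪ B \ T := by
    ext x
    have := @hT x
    grind
  have hT' : T = T.erase g ∪ {g} := by
    ext x
    grind
  have hd : Disjoint (T.erase g) (B \ T) :=
    disjoint_sdiff.mono_left (erase_subset _ _)
  have hdg : Disjoint (T.erase g) {g} := by simp
  have hZ : Disjoint Z (B \ T) := hZB.mono_right sdiff_subset
  have hZg : Disjoint Z {g} := by simpa using hgZ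
  constructor
  · intro h
    refine hc.union_lt_union hnd hZ hZg (hc.lt_of_union_lt_union (T.erase g) hd hdg ?_)
    rwa [← hB, ← hT']
  · intro h
    refine hc.union_lt_union hnd hZg hZ (hc.lt_of_union_lt_union (T.erase g) hdg hd ?_)
    rwa [← hB, ← hT']

end Cancelable

section Representatives

variable {ι : Type*} {n : ℕ} {v : Fin n → Finset ι → ℝ} {X : Fin n → Finset ι}

/-- Agent `i` has the valuation of `a` and holds a bundle at least as good as that of `a`. -/
def IsRepresentedBy (v : Fin n → Finset ι → ℝ) (X : Fin n → Finset ι) (a i : Fin n) : Prop :=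
  v i = v a ∧ v a (X a) ≤ v a (X i)

theorem IsRepresentedBy.envies {a i : Fin n} (h : IsRepresentedBy v X a i) {S : Finset ι}
    (hi : EnviesSet v X i S) : EnviesSet v X a S := by
  rw [EnviesSet, h.1] at hi
  exact h.2.trans_lt hi

theorem exists_representatives (hn : 0 < n) {va vb : Finset ι → ℝ}
    (hv : ∀ i, v i = va ∨ v i = vb) :
    ∃ a b : Fin n, ∀ i, IsRepresentedBy v X a i ∨ IsRepresentedBy v X b i := by
  have key : ∀ w : Finset ι → ℝ, (∃ i, v i = w) →
      ∃ a, ∀ i, v i = w → IsRepresentedBy v X a i := by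
    classical
    rintro w ⟨i₀, hi₀⟩
    obtain ⟨a, ha, hmin⟩ := exists_min_image (univ.filter fun i => v i = w) (fun i => w (X i))
      ⟨i₀, by simpa using hi₀⟩
    have ha' : v a = w := by simpa using ha
    refine ⟨a, fun i hi => ⟨hi.trans ha'.symm, ?_⟩⟩
    rw [ha']
    exact hmin i (by simpa using hi)
  by_cases hA : ∃ i, v i = va
  · obtain ⟨a, ha⟩ := key va hA
    by_cases hB : ∃ i, v i = vb
    · obtain ⟨b, hb⟩ := key vb hB
      exact ⟨a, b, fun i => (hv i).imp (ha i) (hb i)⟩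
    · exact ⟨a, a, fun i => Or.inl (ha i ((hv i).resolve_right fun h => hB ⟨i, h⟩))⟩
  · have hB : ∀ i, v i = vb := fun i => (hv i).resolve_left fun h => hA ⟨i, h⟩
    obtain ⟨b, hb⟩ := key vb ⟨⟨0, hn⟩, hB _⟩
    exact ⟨b, b, fun i => Or.inl (hb i (hB i))⟩

end Representatives

section Allocation

variable {ι : Type*} [DecidableEq ι] {n : ℕ} {v : Fin n → Finset ι → ℝ}
  {X : Fin n → Finset ι}

theorem exists_subset_envied_not_strongly_envied {S : Finset ι} (hS : ∃ i, EnviesSet v X i S) :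
    ∃ T ⊆ S, (∃ i, EnviesSet v X i T) ∧ ∀ j, ¬ StrongEnviesSet v X j T := by
  induction S using Finset.strongInduction with
  | H S ih =>
    by_cases h : ∃ j, StrongEnviesSet v X j S
    · obtain ⟨j, x, hx, hj⟩ := h
      obtain ⟨T, hT, h⟩ := ih _ (erase_ssubset hx) ⟨j, hj⟩
      exact ⟨T, hT.trans (erase_subset _ _), h⟩
    · exact ⟨S, Subset.rfl, hS, not_exists.1 h⟩

theorem isEFX_of_forall_le {Y : Fin n → Finset ι} (hle : ∀ i, v i (X i) ≤ v i (Y i))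
    (h : ∀ i j, i ≠ j → ¬ StrongEnviesSet v X i (Y j)) : IsEFX v Y := by
  rintro i j hij ⟨x, hx, hlt⟩
  exact h i j hij ⟨x, hx, (hle i).trans_lt hlt⟩

theorem exists_dominating_of_update (hX : IsPartialAlloc X) (hEFX : IsEFX v X)
    {p : Fin n} {P : Finset ι} (hP : EnviesSet v X p P)
    (hPX : ∀ j, j ≠ p → Disjoint P (X j)) (hPs : ∀ j, ¬ StrongEnviesSet v X j P) :
    ∃ Y : Fin n → Finset ι, IsPartialAlloc Y ∧ IsEFX v Y ∧ ParetoDominates v Y X := by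
  have hle : ∀ i, v i (X i) ≤ v i (Function.update X p P i) := by
    intro i
    by_cases hi : i = p
    · subst hi
      simpa using hP.le
    · simp [hi]
  refine ⟨Function.update X p P, fun i j hij => ?_, isEFX_of_forall_le hle fun i j hij => ?_,
    hle, p, by simpa [EnviesSet] using hP⟩
  · by_cases hi : i = p
    · subst hi
      simpa [hij.symm] using hPX j hij.symm
    · by_cases hj : j = p
      · subst hj
        simpa [hi] using (hPX i hi).symm
      · simpa [hi, hj] using hX i j hij
  · by_cases hj : j = p
    · subst hj
      simpa using hPs i
    · simpa [hj] using hEFX i j hij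

theorem exists_dominating_of_update_update (hX : IsPartialAlloc X) (hEFX : IsEFX v X)
    {p q : Fin n} (hpq : p ≠ q) {P Q : Finset ι}
    (hP : EnviesSet v X p P) (hQ : EnviesSet v X q Q) (hPQ : Disjoint P Q)
    (hPX : ∀ j, j ≠ p → j ≠ q → Disjoint P (X j)) (hQX : ∀ j, j ≠ p → j ≠ q → Disjoint Q (X j))
    (hPs : ∀ j, ¬ StrongEnviesSet v X j P) (hQs : ∀ j, ¬ StrongEnviesSet v X j Q) :
    ∃ Y : Fin n → Finset ι, IsPartialAlloc Y ∧ IsEFX v Y ∧ ParetoDominates v Y X := by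
  let Y : Fin n → Finset ι := fun i => if i = p then P else if i = q then Q else X i
  have hYp : Y p = P := by simp [Y]
  have hYq : Y q = Q := by simp [Y, hpq.symm]
  have hYo : ∀ j, j ≠ p → j ≠ q → Y j = X j := fun j h h' => by simp [Y, h, h']
  have hle : ∀ i, v i (X i) ≤ v i (Y i) := by
    intro i
    by_cases hi : i = p
    · rw [hi, hYp]
      exact hP.le
    · by_cases hi' : i = q
      · rw [hi', hYq]
        exact hQ.le
      · rw [hYo i hi hi']
  refine ⟨Y, fun i j hij => ?_, isEFX_of_forall_le hle fun i j hij => ?_,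
    hle, p, by rw [hYp]; exact hP⟩
  · have hXij := hX i j hij
    have := hPX i
    have := hPX j
    have := hQX i
    have := hQX j
    have := hPQ.symm
    simp only [disjoint_comm] at *
    dsimp only [Y]
    split_ifs <;> simp_all [disjoint_comm]
  · by_cases hj : j = p
    · rw [hj, hYp]
      exact hPs i
    · by_cases hj' : j = q
      · rw [hj', hYq]
        exact hQs i
      · rw [hYo j hj hj']
        exact hEFX i j hij

theorem exists_subset_envied_of_represented {a b : Fin n}
    (hrep : ∀ i, IsRepresentedBy v X a i ∨ IsRepresentedBy v X b i) {S : Finset ι}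
    (hS : ∃ i, EnviesSet v X i S) :
    ∃ T ⊆ S, (EnviesSet v X a T ∨ EnviesSet v X b T) ∧ ∀ j, ¬ StrongEnviesSet v X j T := by
  obtain ⟨T, hTS, ⟨i, hi⟩, hT⟩ := exists_subset_envied_not_strongly_envied hS
  exact ⟨T, hTS, (hrep i).imp (fun h => h.envies hi) (fun h => h.envies hi), hT⟩

variable {a b : Fin n} {g : ι}

/-- If `g` is unallocated, then either a dominating EFX allocation exists, or some part of
`insert g (X a)` is envied by `b` but not by `a`, and `a` does not envy `b`. -/
theorem exists_dominating_or_exists_champion (hX : IsPartialAlloc X) (hEFX : IsEFX v X)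
    (hval : ∀ i, IsValuation (v i)) (hnd : ∀ i, NonDegenerate (v i))
    (hrep : ∀ i, IsRepresentedBy v X a i ∨ IsRepresentedBy v X b i) (hg : ∀ i, g ∉ X i) :
    (∃ Y : Fin n → Finset ι, IsPartialAlloc Y ∧ IsEFX v Y ∧ ParetoDominates v Y X) ∨
      ∃ T ⊆ insert g (X a), EnviesSet v X b T ∧ ¬ EnviesSet v X a T ∧
        ¬ EnviesSet v X a (X b) := by
  have hdisj : ∀ T ⊆ insert g (X a), ∀ j, j ≠ a → Disjoint T (X j) := fun T hT j hj =>
    (disjoint_insert_left.2 ⟨hg j, hX a j hj.symm⟩).mono_left hT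
  have hself : EnviesSet v X a (insert g (X a)) :=
    lt_of_le_of_ne ((hval a).2.2 (subset_insert g _))
      (hnd a _ _ fun h => hg a (h ▸ mem_insert_self g _))
  obtain ⟨T, hT, hTe, hTs⟩ := exists_subset_envied_of_represented hrep ⟨a, hself⟩
  by_cases haT : EnviesSet v X a T
  · exact Or.inl (exists_dominating_of_update hX hEFX haT (hdisj T hT) hTs)
  have hbT := hTe.resolve_left haT
  by_cases hab : EnviesSet v X a (X b)
  · left
    have hne : a ≠ b := by
      rintro rfl
      exact haT hbT
    refine exists_dominating_of_update_update hX hEFX hne hab hbT (hdisj T hT b hne.symm).symm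
      (fun j _ hj => hX b j hj.symm) (fun j hj _ => hdisj T hT j hj) (fun j => ?_) hTs
    by_cases hj : j = b
    · rintro ⟨x, -, hlt⟩
      subst hj
      exact absurd hlt ((hval j).2.2 (erase_subset _ _)).not_gt
    · exact hEFX j b hj
  · exact Or.inr ⟨T, hT, hbT, haT, hab⟩

/-- The part of `X a` kept by `TA` together with the part of `X b` discarded by `TB` is envied
by `b` but not by `a`. -/
theorem envies_union_sdiff (hX : IsPartialAlloc X) (hab : a ≠ b)
    (hnd : ∀ i, NonDegenerate (v i)) (hc : ∀ i, Cancelable (v i)) (hg : ∀ i, g ∉ X i)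
    {TA TB : Finset ι} (hTA : TA ⊆ insert g (X a)) (hgA : g ∈ TA)
    (hTB : TB ⊆ insert g (X b)) (hgB : g ∈ TB)
    (hbA : EnviesSet v X b TA) (haA : ¬ EnviesSet v X a TA)
    (haB : EnviesSet v X a TB) (hbB : ¬ EnviesSet v X b TB)
    (hanb : ¬ EnviesSet v X a (X b)) :
    EnviesSet v X b (TA.erase g ∪ X b \ TB) ∧ ¬ EnviesSet v X a (TA.erase g ∪ X b \ TB) := by
  have hTA' : TA.erase g ∪ {g} = TA := by
    ext x
    grind
  have hZ : Disjoint (TA.erase g) (X b) :=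
    (hX a b hab).mono_left (by rwa [← subset_insert_iff])
  have hex := fun i => (hc i).exchange (hnd i) (hg b) hTB hgB hZ (notMem_erase g TA)
  rw [hTA'] at hex
  unfold EnviesSet at *
  constructor
  · have hne : v b TB ≠ v b (X b) := hnd b _ _ fun h => hg b (h ▸ hgB)
    exact hbA.trans ((hex b).2 (lt_of_le_of_ne (not_lt.1 hbB) hne))
  · have := (hex a).1 ((not_lt.1 hanb).trans_lt haB)
    linarith [not_lt.1 haA]

theorem exists_dominating_of_represented (hX : IsPartialAlloc X) (hEFX : IsEFX v X)
    (hval : ∀ i, IsValuation (v i)) (hnd : ∀ i, NonDegenerate (v i))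
    (hc : ∀ i, Cancelable (v i))
    (hrep : ∀ i, IsRepresentedBy v X a i ∨ IsRepresentedBy v X b i) (hg : ∀ i, g ∉ X i) :
    ∃ Y : Fin n → Finset ι, IsPartialAlloc Y ∧ IsEFX v Y ∧ ParetoDominates v Y X := by
  rcases exists_dominating_or_exists_champion hX hEFX hval hnd hrep hg with
    h | ⟨TA, hTA, hbA, haA, hanb⟩
  · exact h
  rcases exists_dominating_or_exists_champion hX hEFX hval hnd (fun i => (hrep i).symm) hg with
    h | ⟨TB, hTB, haB, hbB, hbna⟩
  · exact h
  have hab : a ≠ b := by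
    rintro rfl
    exact haA hbA
  have hmem : ∀ {i j : Fin n} {T : Finset ι}, T ⊆ insert g (X i) → EnviesSet v X j T →
      ¬ EnviesSet v X j (X i) → g ∈ T := by
    intro i j T hT hj hji
    by_contra hgT
    exact hji (hj.trans_le ((hval j).2.2 ((subset_insert_iff_of_notMem hgT).1 hT)))
  have hgA := hmem hTA hbA hbna
  have hgB := hmem hTB haB hanb
  obtain ⟨hbP, haP⟩ := envies_union_sdiff hX hab hnd hc hg hTA hgA hTB hgB hbA haA haB hbB hanb
  obtain ⟨haQ, hbQ⟩ :=
    envies_union_sdiff hX hab.symm hnd hc hg hTB hgB hTA hgA haB hbB hbA haA hbna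
  have hsub : ∀ {i : Fin n} {S T : Finset ι}, T ⊆ S → ¬ EnviesSet v X i S →
      ¬ EnviesSet v X i T :=
    fun hTS hS hT => hS (hT.trans_le ((hval _).2.2 hTS))
  obtain ⟨P, hP, hPe, hPs⟩ := exists_subset_envied_of_represented hrep ⟨b, hbP⟩
  obtain ⟨Q, hQ, hQe, hQs⟩ := exists_subset_envied_of_represented hrep ⟨a, haQ⟩
  have hA : TA.erase g ⊆ X a := by rwa [← subset_insert_iff]
  have hB : TB.erase g ⊆ X b := by rwa [← subset_insert_iff]
  have hPQ : Disjoint (TB.erase g ∪ X a \ TA) (TA.erase g ∪ X b \ TB) := by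
    have hd := disjoint_left.1 (hX a b hab)
    rw [disjoint_left]
    intro x
    have := @hA x
    have := @hB x
    have := @hd x
    grind
  refine exists_dominating_of_update_update hX hEFX hab (hQe.resolve_right (hsub hQ hbQ))
    (hPe.resolve_left (hsub hP haP)) (hPQ.mono hQ hP) (fun j hja hjb => ?_)
    (fun j hja hjb => ?_) hQs hPs
  · exact (disjoint_union_left.2 ⟨(hX b j hjb.symm).mono_left hB,
      (hX a j hja.symm).mono_left sdiff_subset⟩).mono_left hQ
  · exact (disjoint_union_left.2 ⟨(hX a j hja.symm).mono_left hA,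
      (hX b j hjb.symm).mono_left sdiff_subset⟩).mono_left hP

end Allocation

/-- If `va` and `vb` are two non-degenerate cancelable valuations,
each of the `n` agents has valuation `va` or `vb`, and `X` is a partial EFX
allocation with at least one unallocated item, then some partial EFX allocation
Pareto dominates `X`. -/
theorem efx_two_valuation_types_pareto_dominating
    {ι : Type*} [DecidableEq ι] [Fintype ι] {n : ℕ} (hn : 0 < n)
    (va vb : Finset ι → ℝ)
    (hva : IsValuation va) (hvb : IsValuation vb)
    (hnda : NonDegenerate va) (hca : Cancelable va)
    (hndb : NonDegenerate vb) (hcb : Cancelable vb)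
    (v : Fin n → Finset ι → ℝ) (hv : ∀ i, v i = va ∨ v i = vb)
    (X : Fin n → Finset ι) (hX : IsPartialAlloc X) (hEFX : IsEFX v X)
    (hU : 1 ≤ (unalloc X).card) :
    ∃ Y : Fin n → Finset ι, IsPartialAlloc Y ∧ IsEFX v Y ∧ ParetoDominates v Y X := by
  obtain ⟨a, b, hrep⟩ := exists_representatives (X := X) hn hv
  obtain ⟨g, hg⟩ := card_pos.1 hU
  have hg' : ∀ i, g ∉ X i := by simpa [unalloc] using hg
  have hall : ∀ i, IsValuation (v i) ∧ NonDegenerate (v i) ∧ Cancelable (v i) := by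
    intro i
    rcases hv i with h | h <;> rw [h]
    · exact ⟨hva, hnda, hca⟩
    · exact ⟨hvb, hndb, hcb⟩
  exact exists_dominating_of_represented hX hEFX (fun i => (hall i).1) (fun i => (hall i).2.1)
    (fun i => (hall i).2.2) hrep hg'

end FairDivision
end

section
/- Let X be a partial EFX allocation for agents with non-degenerate cancelable valuations, let g be an unallocated item, and let C be a good g-cycle with induced decompositions X_j = T_j ∪ B_j for agents j on C. Let i, j, k be agents on C. If k ▷_{B_i | B_j} j, then there exists an agent a (not necessarily on C) such that a ▷_{B_i | B_{succ(k)}} succ(k); in particular, the set T_{succ(k)} ∪ B_i has a most envious agent. -/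
namespace FairDivision

open Finset

/-- A good `g`-cycle for the partial EFX allocation `X`: a cycle of `k ≥ 2`
distinct agents all of whose edges are `g`-champion edges, with no parallel envy
edges and no internal `g`-champion edges, together with the induced
`g`-decompositions `X (a t) = T t ∪ B t`: `B t` is the (bottom half-bundle)
discard set of the edge from the predecessor of `a t` into `a t`, so `a t`
envies `(X (a (t+1)) \ B (t+1)) ∪ {g}` and no agent strongly envies it. -/
structure GoodCycle {ι : Type*} [DecidableEq ι] [Fintype ι] {n : ℕ}
    (v : Fin n → Finset ι → ℝ) (X : Fin n → Finset ι) (g : ι) where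
  k : ℕ
  two_le : 2 ≤ k
  a : ZMod k → Fin n
  inj : Function.Injective a
  champ : ∀ t : ZMod k, ChampG v X g (a t) (a (t + 1))
  no_envy : ∀ t : ZMod k, ¬ EnviesSet v X (a t) (X (a (t + 1)))
  no_internal : ∀ t s : ZMod k, ChampG v X g (a t) (a s) → s = t + 1
  B : ZMod k → Finset ι
  B_sub : ∀ t : ZMod k, B t ⊆ X (a t)
  g_notin_B : ∀ t : ZMod k, g ∉ B t
  B_envy : ∀ t : ZMod k, EnviesSet v X (a t) (insert g (X (a (t + 1)) \ B (t + 1)))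
  B_no_strong : ∀ (t : ZMod k) (j : Fin n),
    ¬ StrongEnviesSet v X j (insert g (X (a (t + 1)) \ B (t + 1)))

/-- A common disjoint part can be cancelled from a strict inequality. -/
theorem Cancelable.lt_of_union_lt_union_s18 {ι : Type*} [DecidableEq ι] {v : Finset ι → ℝ}
    (hv : Cancelable v) {S T : Finset ι} (R : Finset ι) (hS : Disjoint S R) (hT : Disjoint T R)
    (h : v (R ∪ S) < v (R ∪ T)) : v S < v T := by
  induction R using Finset.induction_on with
  | empty => simpa using h
  | insert x R hx ih =>
    rw [Finset.disjoint_insert_right] at hS hT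
    rw [Finset.insert_union, Finset.insert_union] at h
    exact ih hS.2 hT.2 (hv (R ∪ T) (R ∪ S) x (by simp [hx, hT.1]) (by simp [hx, hS.1]) h)

/-- Every set envied by some agent has a most envious agent. -/
theorem EnviesSet.exists_mostEnvious {ι : Type*} [DecidableEq ι] {n : ℕ}
    {v : Fin n → Finset ι → ℝ} {X : Fin n → Finset ι} {i : Fin n} {S : Finset ι}
    (h : EnviesSet v X i S) : ∃ b, MostEnvious v X b S := by
  induction S using Finset.strongInduction generalizing i with
  | H S ih =>
    by_cases hS : ∃ j, StrongEnviesSet v X j S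
    · obtain ⟨j, x, hx, hj⟩ := hS
      obtain ⟨b, T, hT, hb⟩ := ih (S.erase x) (Finset.erase_ssubset hx) (i := j) hj
      exact ⟨b, T, hT.trans (Finset.erase_subset x S), hb⟩
    · exact ⟨i, S, Subset.rfl, h, not_exists.mp hS⟩

/-- An agent on a good cycle envies the top half-bundle of an agent on the cycle together with
`g` only if that agent is its successor. -/
theorem GoodCycle.eq_succ_of_envies {ι : Type*} [DecidableEq ι] [Fintype ι] {n : ℕ}
    {v : Fin n → Finset ι → ℝ} {X : Fin n → Finset ι} {g : ι} (C : GoodCycle v X g)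
    {r s : ZMod C.k} (h : EnviesSet v X (C.a r) (insert g (X (C.a s) \ C.B s))) :
    s = r + 1 := by
  refine C.no_internal r s
    ⟨_, Finset.insert_subset_insert g Finset.sdiff_subset, h, fun j => ?_⟩
  simpa using C.B_no_strong (s - 1) j

/-- Let `C` be a good `g`-cycle for a partial EFX allocation `X`
(agents with non-degenerate cancelable valuations, `g` unallocated), and let
`a t`, `a s`, `a r` be agents on the cycle.  If `a r ▷_{B t | B s} a s`, then
there exists an agent `b` (not necessarily on the cycle) such that
`b ▷_{B t | B (r+1)} a (r+1)`; in particular `T (r+1) ∪ B t` has a most envious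
agent. -/
theorem good_cycle_edge_discovery_step
    {ι : Type*} [DecidableEq ι] [Fintype ι] {n : ℕ}
    (v : Fin n → Finset ι → ℝ) (hval : ∀ i, IsValuation (v i))
    (hnd : ∀ i, NonDegenerate (v i)) (hc : ∀ i, Cancelable (v i))
    (X : Fin n → Finset ι) (hX : IsPartialAlloc X) (hEFX : IsEFX v X)
    (g : ι) (hg : g ∈ unalloc X) (C : GoodCycle v X g) :
    ∀ t s r : ZMod C.k,
      GenChamp v X (C.a r) (C.a s) (C.B t) (C.B s) →
      ∃ b : Fin n, GenChamp v X b (C.a (r + 1)) (C.B t) (C.B (r + 1)) := by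
  intro t s r ⟨hdisj, hsub, S, hS, hSenv, hSstrong⟩
  by_cases hs : s = r + 1
  · subst hs
    exact ⟨C.a r, hdisj, hsub, S, hS, hSenv, hSstrong⟩
  have hgX (i : Fin n) : g ∉ X i := by
    simp only [unalloc, mem_sdiff, mem_biUnion, mem_univ, true_and, not_exists] at hg
    exact hg i
  have hg_top (u : ZMod C.k) : Disjoint {g} (X (C.a u) \ C.B u) := by
    simp [hgX]
  have hB_top : Disjoint (C.B t) (X (C.a s) \ C.B s) := hdisj.mono_right sdiff_subset
  have henv : v (C.a r) (X (C.a r)) < v (C.a r) ((X (C.a s) \ C.B s) ∪ C.B t) :=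
    lt_of_lt_of_le hSenv ((hval _).2.2 hS)
  have hnot : ¬ v (C.a r) (X (C.a r)) < v (C.a r) ((X (C.a s) \ C.B s) ∪ {g}) := fun h =>
    hs (C.eq_succ_of_envies (by rwa [union_singleton] at h))
  have hg_lt : v (C.a r) {g} < v (C.a r) (C.B t) :=
    (hc _).lt_of_union_lt_union_s18 _ (hg_top s) hB_top ((not_lt.mp hnot).trans_lt henv)
  have hsucc : v (C.a r) (X (C.a r)) <
      v (C.a r) ((X (C.a (r + 1)) \ C.B (r + 1)) ∪ {g}) := by
    rw [union_singleton]
    exact C.B_envy r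
  have ht : t ≠ r + 1 := by
    rintro rfl
    have hle := not_lt.mp (C.no_envy r)
    refine hg_lt.not_gt ((hc _).lt_of_union_lt_union_s18 _ sdiff_disjoint.symm (hg_top (r + 1)) ?_)
    rw [sdiff_union_of_subset (C.B_sub _)]
    exact hle.trans_lt hsucc
  have hdisj' : Disjoint (C.B t) (X (C.a (r + 1))) :=
    (hX _ _ (C.inj.ne ht)).mono_left (C.B_sub t)
  have henv' : EnviesSet v X (C.a r) ((X (C.a (r + 1)) \ C.B (r + 1)) ∪ C.B t) := by
    by_contra h
    exact hg_lt.not_gt ((hc _).lt_of_union_lt_union_s18 _ (hdisj'.mono_right sdiff_subset)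
      (hg_top (r + 1)) ((not_lt.mp h).trans_lt hsucc))
  obtain ⟨b, hb⟩ := henv'.exists_mostEnvious
  exact ⟨b, hdisj', C.B_sub _, hb⟩

end FairDivision
end
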